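/- Associativity of the composition of orientations. Let (A_i, B_i, C_i, μ_i) for i = 1, 2, 3 be orientation data, and let f₁₂ : A₂ → B₁ ⊕ B₂ and f₂₃ : A₃ → B₂ ⊕ B₃ be linear maps. Define f : A₂ ⊕ A₃ → B₁ ⊕ B₂ ⊕ B₃ by f(a₂, a₃) = ((f₁₂a₂)₁, (f₁₂a₂)₂ + (f₂₃a₃)₁, (f₂₃a₃)₂), and, with q₁₂ : B₁ ⊕ B₂ → coker(f₁₂) and q₂₃ : B₂ ⊕ B₃ → coker(f₂₃) the quotient maps, define f₍₁₂,₃₎ : A₃ → coker(f₁₂) ⊕ B₃ by f₍₁₂,₃₎(a) = (q₁₂(0, (f₂₃a)₁), (f₂₃a)₂) and f₍₁,₂₃₎ : A₂ → B₁ ⊕ coker(f₂₃) by f₍₁,₂₃₎(a) = ((f₁₂a)₁, q₂₃((f₁₂a)₂, 0)). Define the composed data 𝒜₂ ∘_{f₁₂} 𝒜₁ := (A₁, coker(f₁₂), C₁ ⊕ C₂ ⊕ ker(f₁₂), μ₂ ∘_{f₁₂} μ₁), and similarly for the other compositions. Then, under the canonical isomorphisms coker(f₍₁₂,₃₎) ≅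 coker(f) ≅ coker(f₍₁,₂₃₎) induced by the quotient maps on B₁ ⊕ B₂ ⊕ B₃, any isomorphisms ker(f) ≅ ker(f₁₂) ⊕ ker(f₍₁₂,₃₎) and ker(f) ≅ ker(f₂₃) ⊕ ker(f₍₁,₂₃₎) obtained from linear sections of the canonical short exact sequences, and the shuffle isomorphisms reordering the direct summands of the C-slots, the two iterated composites agree: 𝒜₃ ∘_{f₍₁₂,₃₎} (𝒜₂ ∘_{f₁₂} 𝒜₁) = (𝒜₃ ∘_{f₂₃} 𝒜₂) ∘_{f₍₁,₂₃₎} 𝒜₁ as orientations of coker(f) ⊕ A₁ ⊕ (C₁ ⊕ C₂ ⊕ C₃ ⊕ ker(f)). -/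

import Mathlib

open Module

noncomputable section

/-- The concatenation of a basis of `V` and a basis of `W`, as a basis of `V × W`.
On orientations this realizes the wedge `ω ∧ ω'` of orientations. -/
def prodBasis {V W : Type*} [AddCommGroup V] [Module ℝ V]
    [AddCommGroup W] [Module ℝ W] {m n : ℕ}
    (bv : Basis (Fin m) ℝ V) (bw : Basis (Fin n) ℝ W) :
    Basis (Fin (m + n)) ℝ (V × W) :=
  (bv.prod bw).reindex finSumFinEquiv

/-- Given orientation data `(Aᵢ, Bᵢ, Cᵢ, μᵢ)` for `i = 1, 2` and a linear map
`f : A₂ → B₁ ⊕ B₂`, the proposition that the orientation `ν` of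
`coker f ⊕ A₁ ⊕ (C₁ ⊕ C₂ ⊕ ker f)` is obtained from some system of choices as in the
definition of the composite orientation `μ₂ ∘_f μ₁`. -/
def IsCompositeOrientation
    {A₁ B₁ C₁ A₂ B₂ C₂ : Type*}
    [AddCommGroup A₁] [Module ℝ A₁] [AddCommGroup B₁] [Module ℝ B₁]
    [AddCommGroup C₁] [Module ℝ C₁] [AddCommGroup A₂] [Module ℝ A₂]
    [AddCommGroup B₂] [Module ℝ B₂] [AddCommGroup C₂] [Module ℝ C₂]
    {na₁ nb₁ nc₁ na₂ nb₂ nc₂ nk ncok : ℕ}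
    (f : A₂ →ₗ[ℝ] B₁ × B₂)
    (μ₁ : Orientation ℝ (B₁ × (A₁ × C₁)) (Fin (nb₁ + (na₁ + nc₁))))
    (μ₂ : Orientation ℝ (B₂ × (A₂ × C₂)) (Fin (nb₂ + (na₂ + nc₂))))
    (ν : Orientation ℝ
      (((B₁ × B₂) ⧸ LinearMap.range f) × (A₁ × (C₁ × (C₂ × ↥(LinearMap.ker f)))))
      (Fin (ncok + (na₁ + (nc₁ + (nc₂ + nk)))))) : Prop :=
  ∃ (a₁ : Basis (Fin na₁) ℝ A₁) (b₁ : Basis (Fin nb₁) ℝ B₁)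
    (c₁ : Basis (Fin nc₁) ℝ C₁) (a₂ : Basis (Fin na₂) ℝ A₂)
    (b₂ : Basis (Fin nb₂) ℝ B₂) (c₂ : Basis (Fin nc₂) ℝ C₂)
    (dl : Basis (Fin (finrank ℝ ↥(LinearMap.range f))) ℝ ↥(LinearMap.range f))
    (e : Basis (Fin ncok) ℝ ((B₁ × B₂) ⧸ LinearMap.range f))
    (z : Basis (Fin nk) ℝ ↥(LinearMap.ker f))
    (F : (↥(LinearMap.range f) × ((B₁ × B₂) ⧸ LinearMap.range f)) ≃ₗ[ℝ] B₁ × B₂)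
    (G : (↥(LinearMap.ker f) × ↥(LinearMap.range f)) ≃ₗ[ℝ] A₂)
    (hFi : finrank ℝ ↥(LinearMap.range f) + ncok = nb₁ + nb₂)
    (hGi : nk + finrank ℝ ↥(LinearMap.range f) = na₂),
    (∀ x : ↥(LinearMap.range f), F (x, 0) = (x : B₁ × B₂)) ∧
    (∀ y : (B₁ × B₂) ⧸ LinearMap.range f,
      Submodule.mkQ (LinearMap.range f) (F (0, y)) = y) ∧
    (∀ x : ↥(LinearMap.ker f), G (x, 0) = (x : A₂)) ∧
    (∀ y : ↥(LinearMap.range f), f (G (0, y)) = (y : B₁ × B₂)) ∧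
    μ₁ = (prodBasis b₁ (prodBasis a₁ c₁)).orientation ∧
    μ₂ = (prodBasis b₂ (prodBasis a₂ c₂)).orientation ∧
    Orientation.reindex ℝ _ (finCongr hFi) ((prodBasis dl e).map F).orientation =
      (prodBasis b₁ b₂).orientation ∧
    Orientation.reindex ℝ _ (finCongr hGi) ((prodBasis z dl).map G).orientation =
      a₂.orientation ∧
    ν = (if (nb₁ * na₂ + nb₁ * nc₂ + na₂ * nc₂ +
            finrank ℝ ↥(LinearMap.range f) * (finrank ℝ ↥(LinearMap.range f) - 1) / 2) % 2 = 0
      then (prodBasis e (prodBasis a₁ (prodBasis c₁ (prodBasis c₂ z)))).orientation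
      else -(prodBasis e (prodBasis a₁ (prodBasis c₁ (prodBasis c₂ z)))).orientation)

section RelSign

variable {V W U V' W' : Type*} [AddCommGroup V] [Module ℝ V] [AddCommGroup W] [Module ℝ W]
  [AddCommGroup U] [Module ℝ U] [AddCommGroup V'] [Module ℝ V'] [AddCommGroup W'] [Module ℝ W']
  {m n p m' n' : ℕ}

theorem Module.Basis.fin_dim_eq (X : Basis (Fin m) ℝ V) (Y : Basis (Fin n) ℝ V) : m = n := by
  have hX := finrank_eq_card_basis X
  have hY := finrank_eq_card_basis Y
  simp only [Fintype.card_fin] at hX hY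
  omega

open Classical in
/-- The sign of an orientation relative to the orientation of a basis. -/
def Orientation.basisSign (μ : Orientation ℝ V (Fin n)) (X : Basis (Fin n) ℝ V) : ℤˣ :=
  if μ = X.orientation then 1 else -1

/-- The sign of the change of basis between two bases, whose index types need only have
propositionally equal cardinalities. -/
def relSign (X : Basis (Fin m) ℝ V) (Y : Basis (Fin n) ℝ V) : ℤˣ :=
  X.orientation.basisSign (Y.reindex (finCongr (Y.fin_dim_eq X)))

/-- The sign of the determinant of a linear equivalence with respect to bases of its source and
of its target. -/
def LinearEquiv.orSign (e : V ≃ₗ[ℝ] W) (X : Basis (Fin m) ℝ V) (Y : Basis (Fin n) ℝ W) : ℤˣ :=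
  relSign (X.map e) Y

theorem Orientation.basisSign_self (X : Basis (Fin n) ℝ V) : X.orientation.basisSign X = 1 := by
  simp [Orientation.basisSign]

theorem Orientation.basisSign_neg (μ : Orientation ℝ V (Fin n)) (X : Basis (Fin n) ℝ V) :
    (-μ).basisSign X = -μ.basisSign X := by
  have hn := (Module.Ray.ne_neg_self X.orientation).symm
  rcases X.orientation_eq_or_eq_neg μ with h | h <;> subst h
  · simp [Orientation.basisSign, hn]
  · have hnn : - -X.orientation = X.orientation := neg_neg (X.orientation : Module.Ray ℝ _)
    simp [Orientation.basisSign, hn, hnn]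

theorem Orientation.ext_basisSign {μ ν : Orientation ℝ V (Fin n)} (X : Basis (Fin n) ℝ V)
    (h : μ.basisSign X = ν.basisSign X) : μ = ν := by
  rcases X.orientation_eq_or_eq_neg μ with h₁ | h₁ <;>
  rcases X.orientation_eq_or_eq_neg ν with h₂ | h₂ <;> subst h₁ <;> subst h₂ <;>
    simp_all [Orientation.basisSign, (Module.Ray.ne_neg_self _).symm]

theorem Orientation.basisSign_map (μ : Orientation ℝ V (Fin n)) (X : Basis (Fin n) ℝ V)
    (e : V ≃ₗ[ℝ] W) : (Orientation.map (Fin n) e μ).basisSign (X.map e) = μ.basisSign X := by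
  have h : Orientation.map (Fin n) e μ = (X.map e).orientation ↔ μ = X.orientation := by
    rw [Basis.orientation_map]
    exact (Orientation.map (Fin n) e).apply_eq_iff_eq
  rw [Orientation.basisSign, Orientation.basisSign]
  by_cases hμ : μ = X.orientation
  · rw [if_pos hμ, if_pos (h.2 hμ)]
  · rw [if_neg hμ, if_neg (mt h.1 hμ)]

theorem Orientation.basisSign_reindex (μ : Orientation ℝ V (Fin m)) (X : Basis (Fin m) ℝ V)
    (h : m = n) (Y : Basis (Fin n) ℝ V) :
    (Orientation.reindex ℝ _ (finCongr h) μ).basisSign Y = μ.basisSign X * relSign X Y := by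
  subst h
  have h1 : Orientation.reindex ℝ V (finCongr (rfl : m = m)) μ = μ := by
    rw [finCongr_refl, Orientation.reindex_refl]; rfl
  have h2 : Y.reindex (finCongr (Y.fin_dim_eq X)) = Y := by
    rw [finCongr_refl, Basis.reindex_refl]
  rw [h1, relSign, h2]
  rcases X.orientation_eq_or_eq_neg μ with h | h
  · subst h; rw [basisSign_self, one_mul]
  · subst h; rw [basisSign_neg, basisSign_neg, basisSign_self, neg_one_mul]

theorem Orientation.basisSign_mul_relSign (μ : Orientation ℝ V (Fin n)) (X Y : Basis (Fin n) ℝ V) :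
    μ.basisSign Y = μ.basisSign X * relSign X Y := by
  rw [← μ.basisSign_reindex X rfl Y, finCongr_refl, Orientation.reindex_refl]; rfl

theorem relSign_eq (X Y : Basis (Fin n) ℝ V) : relSign X Y = X.orientation.basisSign Y := by
  rw [relSign, finCongr_refl, Basis.reindex_refl]

theorem relSign_trans (X : Basis (Fin m) ℝ V) (Y : Basis (Fin n) ℝ V) (Z : Basis (Fin p) ℝ V) :
    relSign X Y * relSign Y Z = relSign X Z := by
  obtain rfl := X.fin_dim_eq Y
  obtain rfl := X.fin_dim_eq Z
  rw [relSign_eq, relSign_eq X Z, ← Orientation.basisSign_mul_relSign]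

theorem relSign_self (X : Basis (Fin m) ℝ V) : relSign X X = 1 := by
  rw [relSign_eq, Orientation.basisSign_self]

theorem relSign_comm (X : Basis (Fin m) ℝ V) (Y : Basis (Fin n) ℝ V) :
    relSign X Y = relSign Y X := by
  have h := relSign_trans X Y X
  rw [relSign_self] at h
  exact (eq_inv_of_mul_eq_one_left h).trans (Int.units_inv_eq_self _)

theorem relSign_map (X : Basis (Fin m) ℝ V) (Y : Basis (Fin n) ℝ V) (e : V ≃ₗ[ℝ] W) :
    relSign (X.map e) (Y.map e) = relSign X Y := by
  obtain rfl := X.fin_dim_eq Y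
  rw [relSign_eq, relSign_eq, Basis.orientation_map, Orientation.basisSign_map]

theorem relSign_map_self (X : Basis (Fin m) ℝ V) (e : V ≃ₗ[ℝ] V) :
    relSign X (X.map e) = if 0 < LinearMap.det (e : V →ₗ[ℝ] V) then 1 else -1 := by
  rw [relSign_eq, Orientation.basisSign]
  have := X.orientation_comp_linearEquiv_eq_iff_det_pos e
  rw [eq_comm] at this
  simp only [this]

theorem relSign_prodBasis (X : Basis (Fin m) ℝ V) (Y : Basis (Fin n) ℝ V)
    (X' : Basis (Fin m') ℝ W) (Y' : Basis (Fin n') ℝ W) :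
    relSign (prodBasis X X') (prodBasis Y Y') = relSign X Y * relSign X' Y' := by
  obtain rfl := X.fin_dim_eq Y
  obtain rfl := X'.fin_dim_eq Y'
  have : FiniteDimensional ℝ V := .of_basis X
  have : FiniteDimensional ℝ W := .of_basis X'
  obtain ⟨e, rfl⟩ : ∃ e : V ≃ₗ[ℝ] V, Y = X.map e := ⟨X.equiv Y (Equiv.refl _), by simp⟩
  obtain ⟨e', rfl⟩ : ∃ e : W ≃ₗ[ℝ] W, Y' = X'.map e := ⟨X'.equiv Y' (Equiv.refl _), by simp⟩
  have h : prodBasis (X.map e) (X'.map e') = (prodBasis X X').map (e.prodCongr e') := by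
    apply Basis.eq_of_apply_eq
    intro i
    obtain ⟨j, rfl⟩ := finSumFinEquiv.surjective i
    rcases j with j | j <;> simp [prodBasis]
  rw [h, relSign_map_self, relSign_map_self, relSign_map_self, LinearEquiv.coe_prodCongr,
    LinearMap.det_prodMap]
  have h1 := (LinearEquiv.isUnit_det' e).ne_zero
  have h2 := (LinearEquiv.isUnit_det' e').ne_zero
  rcases h1.lt_or_gt with h1 | h1 <;> rcases h2.lt_or_gt with h2 | h2
  · simp [mul_pos_of_neg_of_neg h1 h2, h1.not_gt, h2.not_gt]
  · simp [(mul_neg_of_neg_of_pos h1 h2).not_gt, h1.not_gt, h2]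
  · simp [(mul_neg_of_pos_of_neg h1 h2).not_gt, h2.not_gt, h1]
  · simp [mul_pos h1 h2, h1, h2]

namespace LinearEquiv

theorem orSign_trans (e : V ≃ₗ[ℝ] W) (e' : W ≃ₗ[ℝ] U) (X : Basis (Fin m) ℝ V)
    (Y : Basis (Fin n) ℝ W) (Z : Basis (Fin p) ℝ U) :
    (e ≪≫ₗ e').orSign X Z = e.orSign X Y * e'.orSign Y Z := by
  rw [orSign, orSign, orSign, ← relSign_map _ _ e', relSign_trans]
  rfl

theorem orSign_trans_of {e : V ≃ₗ[ℝ] W} {e' : W ≃ₗ[ℝ] U} {X : Basis (Fin m) ℝ V}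
    {Y : Basis (Fin n) ℝ W} {Z : Basis (Fin p) ℝ U} {s t : ℤˣ} (h : e.orSign X Y = s)
    (h' : e'.orSign Y Z = t) : (e ≪≫ₗ e').orSign X Z = s * t := by
  rw [orSign_trans e e' X Y Z, h, h']

theorem orSign_refl (X : Basis (Fin m) ℝ V) (Y : Basis (Fin n) ℝ V) :
    (LinearEquiv.refl ℝ V).orSign X Y = relSign X Y := by
  have : X.map (LinearEquiv.refl ℝ V) = X := by ext; simp
  rw [orSign, this]

theorem orSign_refl_self (X : Basis (Fin m) ℝ V) : (LinearEquiv.refl ℝ V).orSign X X = 1 := by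
  rw [orSign_refl, relSign_self]

theorem orSign_symm (e : V ≃ₗ[ℝ] W) (X : Basis (Fin m) ℝ V) (Y : Basis (Fin n) ℝ W) :
    e.symm.orSign Y X = e.orSign X Y := by
  rw [orSign, orSign, ← relSign_map _ _ e, relSign_comm]
  congr 1
  ext
  simp

theorem orSign_change (e : V ≃ₗ[ℝ] W) (X : Basis (Fin m) ℝ V) (Y : Basis (Fin n) ℝ W)
    (X' : Basis (Fin m') ℝ V) (Y' : Basis (Fin n') ℝ W) :
    e.orSign X' Y' = relSign X X' * e.orSign X Y * relSign Y Y' := by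
  rw [orSign, ← relSign_trans _ (X.map e), relSign_map, ← relSign_trans (X.map e) Y,
    relSign_comm X', mul_assoc]
  rfl

theorem orSign_prodCongr (e : V ≃ₗ[ℝ] V') (e' : W ≃ₗ[ℝ] W') (X : Basis (Fin m) ℝ V)
    (Y : Basis (Fin n) ℝ V') (X' : Basis (Fin m') ℝ W) (Y' : Basis (Fin n') ℝ W') :
    (e.prodCongr e').orSign (prodBasis X X') (prodBasis Y Y') =
      e.orSign X Y * e'.orSign X' Y' := by
  rw [orSign, orSign, orSign, ← relSign_prodBasis]
  congr 1

theorem orSign_prodCongr_of {e : V ≃ₗ[ℝ] V'} {e' : W ≃ₗ[ℝ] W'} {X : Basis (Fin m) ℝ V}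
    {Y : Basis (Fin n) ℝ V'} {X' : Basis (Fin m') ℝ W} {Y' : Basis (Fin n') ℝ W'} {s t : ℤˣ}
    (h : e.orSign X Y = s) (h' : e'.orSign X' Y' = t) :
    (e.prodCongr e').orSign (prodBasis X X') (prodBasis Y Y') = s * t := by
  rw [orSign_prodCongr, h, h']

theorem orSign_eq_one_of_apply_eq (e : V ≃ₗ[ℝ] W) (X : Basis (Fin m) ℝ V)
    (Y : Basis (Fin n) ℝ W) (h : m = n) (H : ∀ i, e (X i) = Y (Fin.cast h i)) :
    e.orSign X Y = 1 := by
  subst h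
  have : X.map e = Y := by ext i; simp [H]
  rw [orSign, this, relSign_self]

theorem orSign_prodAssoc (X : Basis (Fin m) ℝ V) (Y : Basis (Fin n) ℝ W)
    (Z : Basis (Fin p) ℝ U) :
    (LinearEquiv.prodAssoc ℝ V W U).orSign (prodBasis (prodBasis X Y) Z)
      (prodBasis X (prodBasis Y Z)) = 1 := by
  refine orSign_eq_one_of_apply_eq _ _ _ (Nat.add_assoc _ _ _) fun i => ?_
  induction i using Fin.addCases with
  | left i =>
    induction i using Fin.addCases with
    | left i =>
      have : Fin.cast (Nat.add_assoc m n p) (Fin.castAdd p (Fin.castAdd n i)) =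
        Fin.castAdd (n + p) i := by ext; simp
      rw [this]
      simp [prodBasis]
    | right i =>
      have : Fin.cast (Nat.add_assoc m n p) (Fin.castAdd p (Fin.natAdd m i)) =
        Fin.natAdd m (Fin.castAdd p i) := by ext; simp
      rw [this]
      simp [prodBasis]
  | right i =>
    have : Fin.cast (Nat.add_assoc m n p) (Fin.natAdd (m + n) i) =
      Fin.natAdd m (Fin.natAdd n i) := by ext; simp [Nat.add_assoc]
    rw [this]
    simp [prodBasis]

end LinearEquiv

theorem negOneUnit_pow_congr {a b : ℕ} (h : (a : ZMod 2) = b) : (-1 : ℤˣ) ^ a = (-1) ^ b := by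
  rw [pow_eq_pow_mod a (n := 2) (by simp), pow_eq_pow_mod b (n := 2) (by simp),
    (ZMod.natCast_eq_natCast_iff' _ _ _).1 h]

theorem sign_finAddFlip (m n : ℕ) (h : n + m = m + n) :
    Equiv.Perm.sign ((finAddFlip (m := m) (n := n)).trans (finCongr h)) = (-1) ^ (m * n) := by
  rcases Nat.eq_zero_or_pos m with rfl | hm
  · have : (finAddFlip (m := 0) (n := n)).trans (finCongr h) = 1 := by
      ext i
      rcases i with ⟨i, hi⟩
      simp [finAddFlip_apply_mk_right (Nat.zero_le i)]
    simp [this]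
  have : (finAddFlip (m := m) (n := n)).trans (finCongr h) =
      finRotate (m + n) ^ n := by
    have hn : n < m + n := by omega
    have key : ((finRotate (m + n) ^ n : Equiv.Perm _) : Fin (m + n) → Fin (m + n)) =
        finCycle ⟨n, hn⟩ := by
      rw [finCycle_eq_finRotate_iterate, Equiv.Perm.coe_pow]
    ext i
    rw [key]
    rcases i with ⟨i, hi⟩
    simp only [finCycle, Equiv.coe_fn_mk, Equiv.trans_apply, Fin.add_def, finCongr_apply]
    rcases lt_or_ge i m with h' | h'
    · rw [finAddFlip_apply_mk_left h']
      simp only [Fin.val_cast]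
      rw [Nat.mod_eq_of_lt (by omega), Nat.add_comm]
    · rw [finAddFlip_apply_mk_right h']
      simp only [Fin.val_cast]
      rw [Nat.mod_eq_sub_mod (by omega), Nat.mod_eq_of_lt (by omega)]
      omega
  rw [this, map_pow, sign_finRotate, ← pow_mul]
  apply negOneUnit_pow_congr
  obtain ⟨k, rfl⟩ := Nat.exists_eq_add_of_le' hm
  have : (k + 1 + n - 1) * n = (k + n) * n := by congr 1; omega
  rw [this]
  rcases Nat.even_or_odd n with ⟨c, rfl⟩ | ⟨c, rfl⟩ <;> push_cast <;> ring_nf <;> reduce_mod_char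

theorem LinearEquiv.orSign_prodComm (X : Basis (Fin m) ℝ V) (Y : Basis (Fin n) ℝ W) :
    (LinearEquiv.prodComm ℝ V W).orSign (prodBasis X Y) (prodBasis Y X) = (-1) ^ (m * n) := by
  set σ := (finAddFlip (m := m) (n := n)).trans (finCongr (Nat.add_comm n m)) with hσ
  set Z := (prodBasis Y X).reindex (finCongr (Nat.add_comm n m)) with hZ
  have h1 : (prodBasis X Y).map (LinearEquiv.prodComm ℝ V W) = Z.reindex σ.symm := by
    apply Basis.eq_of_apply_eq
    intro i
    induction i using Fin.addCases with
    | left i => simp [hZ, hσ, prodBasis]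
    | right i => simp [hZ, hσ, prodBasis]
  have h2 : Z.det (Z.reindex σ.symm) = ((Equiv.Perm.sign σ : ℤˣ) : ℝ) := by
    have : ⇑(Z.reindex σ.symm) = Z ∘ σ := by ext1; simp
    rw [this, AlternatingMap.map_perm, Basis.det_self]
    simp [Units.smul_def]
  rw [LinearEquiv.orSign, relSign, h1, ← hZ, Orientation.basisSign, eq_comm (a := Basis.orientation _)]
  simp only [Basis.orientation_eq_iff_det_pos]
  rw [h2, hσ, sign_finAddFlip]
  rcases neg_one_pow_eq_or ℤˣ (m * n) with h | h <;> rw [h] <;> simp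

theorem LinearMap.det_eq_one_of_shear [FiniteDimensional ℝ V] [FiniteDimensional ℝ W]
    (E : V × W →ₗ[ℝ] V × W) (h₁ : ∀ v, E (v, 0) = (v, 0)) (h₂ : ∀ x, (E x).2 = x.2) :
    LinearMap.det E = 1 := by
  let b := finBasis ℝ V
  let c := finBasis ℝ W
  have : LinearMap.toMatrix (b.prod c) (b.prod c) E =
      Matrix.fromBlocks 1 (LinearMap.toMatrix c b (LinearMap.fst ℝ V W ∘ₗ E ∘ₗ
        LinearMap.inr ℝ V W)) 0 1 := by
    ext i j
    rcases i with i | i <;> rcases j with j | j <;>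
      simp [LinearMap.toMatrix_apply, h₁, h₂, Matrix.one_apply, Finsupp.single_apply, eq_comm]
  rw [← LinearMap.det_toMatrix (b.prod c), this, Matrix.det_fromBlocks_zero₂₁]
  simp

end RelSign

section Split

variable {A A' A'' B B' B'' K K' K'' Q Q' Q'' V W U : Type*}
  [AddCommGroup A] [Module ℝ A] [AddCommGroup A'] [Module ℝ A'] [AddCommGroup A''] [Module ℝ A'']
  [AddCommGroup B] [Module ℝ B] [AddCommGroup B'] [Module ℝ B'] [AddCommGroup B''] [Module ℝ B'']
  [AddCommGroup K] [Module ℝ K] [AddCommGroup K'] [Module ℝ K'] [AddCommGroup K''] [Module ℝ K'']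
  [AddCommGroup Q] [Module ℝ Q] [AddCommGroup Q'] [Module ℝ Q'] [AddCommGroup Q''] [Module ℝ Q'']
  [AddCommGroup V] [Module ℝ V] [AddCommGroup W] [Module ℝ W] [AddCommGroup U] [Module ℝ U]
  {m n p : ℕ}

/-- The exchange of the first two factors of a triple product. -/
def swapMid (V W U : Type*) [AddCommGroup V] [Module ℝ V] [AddCommGroup W] [Module ℝ W]
    [AddCommGroup U] [Module ℝ U] : (V × W × U) ≃ₗ[ℝ] W × V × U :=
  (LinearEquiv.prodAssoc ℝ V W U).symm ≪≫ₗ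
    (LinearEquiv.prodComm ℝ V W).prodCongr (LinearEquiv.refl ℝ U) ≪≫ₗ
    LinearEquiv.prodAssoc ℝ W V U

theorem orSign_swapMid (X : Basis (Fin m) ℝ V) (Y : Basis (Fin n) ℝ W) (Z : Basis (Fin p) ℝ U) :
    (swapMid V W U).orSign (prodBasis X (prodBasis Y Z)) (prodBasis Y (prodBasis X Z)) =
      (-1) ^ (m * n) := by
  refine (LinearEquiv.orSign_trans_of
    ((LinearEquiv.orSign_symm _ _ _).trans (LinearEquiv.orSign_prodAssoc X Y Z))
    (LinearEquiv.orSign_trans_of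
      (LinearEquiv.orSign_prodCongr_of (LinearEquiv.orSign_prodComm X Y)
        (LinearEquiv.orSign_refl_self Z))
      (LinearEquiv.orSign_prodAssoc Y X Z))).trans ?_
  simp

/-- The shear `(v, w) ↦ (v + t w, w)`. -/
def shear (t : W →ₗ[ℝ] V) : (V × W) ≃ₗ[ℝ] V × W where
  toFun x := (x.1 + t x.2, x.2)
  map_add' x y := by ext <;> simp [add_add_add_comm]
  map_smul' c x := by ext <;> simp
  invFun x := (x.1 - t x.2, x.2)
  left_inv x := by ext <;> simp
  right_inv x := by ext <;> simp

@[simp]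
theorem shear_apply (t : W →ₗ[ℝ] V) (x : V × W) : shear t x = (x.1 + t x.2, x.2) := rfl

theorem orSign_shear (t : W →ₗ[ℝ] V) (X : Basis (Fin m) ℝ V) (Y : Basis (Fin n) ℝ W) :
    (shear t).orSign (prodBasis X Y) (prodBasis X Y) = 1 := by
  have : FiniteDimensional ℝ V := .of_basis X
  have : FiniteDimensional ℝ W := .of_basis Y
  rw [LinearEquiv.orSign, relSign_comm, relSign_map_self, LinearMap.det_eq_one_of_shear] <;> simp

/-- An isomorphism `A × Q ≃ K × B` of the form `(a, y) ↦ (r a + ρ y, f a + s y)`, where `r` is a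
retraction onto the kernel `i : K → A` of `f` and `s` is a section of the cokernel `q : B → Q`
of `f`. -/
structure IsSplitting (f : A →ₗ[ℝ] B) (i : K →ₗ[ℝ] A) (q : B →ₗ[ℝ] Q)
    (H : (A × Q) ≃ₗ[ℝ] K × B) : Prop where
  apply_ker : ∀ k, H (i k, 0) = (k, 0)
  quot_apply : ∀ x, q (H x).2 = x.2
  apply_fst : ∀ a, (H (a, 0)).2 = f a

theorem IsSplitting.orSign_eq {f : A →ₗ[ℝ] B} {i : K →ₗ[ℝ] A} {q : B →ₗ[ℝ] Q}
    {H H' : (A × Q) ≃ₗ[ℝ] K × B} (h : IsSplitting f i q H) (h' : IsSplitting f i q H')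
    {na nq nk nb : ℕ} (a : Basis (Fin na) ℝ A) (e : Basis (Fin nq) ℝ Q) (z : Basis (Fin nk) ℝ K)
    (b : Basis (Fin nb) ℝ B) :
    H.orSign (prodBasis a e) (prodBasis z b) = H'.orSign (prodBasis a e) (prodBasis z b) := by
  have : FiniteDimensional ℝ A := .of_basis a
  have : FiniteDimensional ℝ B := .of_basis b
  have : FiniteDimensional ℝ K := .of_basis z
  have : FiniteDimensional ℝ Q := .of_basis e
  have split (L : (A × Q) ≃ₗ[ℝ] K × B) (x : A × Q) : L x = L (x.1, 0) + L (0, x.2) := by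
    rw [← map_add]; simp
  let M : A × Q →ₗ[ℝ] K × B :=
    H.toLinearMap ∘ₗ LinearMap.inl ℝ A Q ∘ₗ LinearMap.fst ℝ A Q +
      H'.toLinearMap ∘ₗ LinearMap.inr ℝ A Q ∘ₗ LinearMap.snd ℝ A Q
  have hM (x : A × Q) : M x = H (x.1, 0) + H' (0, x.2) := rfl
  have h1 : LinearMap.det (H.symm.toLinearMap ∘ₗ M) = 1 := by
    apply LinearMap.det_eq_one_of_shear
    · intro a
      simp [hM]
    · intro x
      rw [LinearMap.comp_apply, LinearEquiv.coe_coe, ← h.quot_apply, LinearEquiv.apply_symm_apply,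
        hM, Prod.snd_add, map_add, h.quot_apply, h'.quot_apply, zero_add]
  have h2 : LinearMap.det (M ∘ₗ H'.symm.toLinearMap) = 1 := by
    apply LinearMap.det_eq_one_of_shear
    · intro k
      have : H'.symm (k, 0) = (i k, 0) := by rw [LinearEquiv.symm_apply_eq, h'.apply_ker]
      simp [this, hM, h.apply_ker]
    · intro x
      obtain ⟨y, rfl⟩ := H'.surjective x
      simp only [LinearMap.comp_apply, LinearEquiv.coe_coe, LinearEquiv.symm_apply_apply, hM]
      rw [split H' y, Prod.snd_add, Prod.snd_add, h.apply_fst, h'.apply_fst]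
  have h3 : LinearMap.det ((H.symm ≪≫ₗ H' : (K × B) ≃ₗ[ℝ] K × B) : K × B →ₗ[ℝ] K × B) = 1 := by
    have : (M ∘ₗ H'.symm.toLinearMap) ∘ₗ (H.symm ≪≫ₗ H' : (K × B) ≃ₗ[ℝ] K × B).toLinearMap =
        H.toLinearMap ∘ₗ (H.symm.toLinearMap ∘ₗ M) ∘ₗ H.symm.toLinearMap := by
      ext x <;> simp
    rw [← one_mul (LinearMap.det _), ← h2, ← LinearMap.det_comp, this, LinearMap.det_conj, h1, h2]
  have : H' = H ≪≫ₗ (H.symm ≪≫ₗ H') := by ext <;> simp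
  rw [this, LinearEquiv.orSign_trans _ _ _ (prodBasis z b), LinearEquiv.orSign.eq_1 _ (prodBasis z b),
    relSign_comm _ (prodBasis z b), relSign_map_self, h3]
  simp

theorem IsSplitting.exists_compose {f' : A' →ₗ[ℝ] B'} {i' : K' →ₗ[ℝ] A'} {q' : B' →ₗ[ℝ] Q'}
    {H' : (A' × Q') ≃ₗ[ℝ] K' × B'} (h' : IsSplitting f' i' q' H')
    {g : A'' →ₗ[ℝ] Q' × B''} {i'' : K'' →ₗ[ℝ] A''} {q'' : Q' × B'' →ₗ[ℝ] Q''}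
    {H'' : (A'' × Q'') ≃ₗ[ℝ] K'' × (Q' × B'')} (h'' : IsSplitting g i'' q'' H'')
    {f : A' × A'' →ₗ[ℝ] B' × B''} {i : K →ₗ[ℝ] A' × A''} {q : B' × B'' →ₗ[ℝ] Q}
    (φ : A'' →ₗ[ℝ] B') (hf : ∀ x, f x = (f' x.1 + φ x.2, (g x.2).2))
    (hg : ∀ a, (g a).1 = q' (φ a)) (Φ : K ≃ₗ[ℝ] K' × K'') (Ψ : Q'' ≃ₗ[ℝ] Q)
    (hi : ∀ k, f (i k) = 0) (hΦ : ∀ k, (i k).2 = i'' (Φ k).2)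
    (hΦ' : ∀ k, i (Φ.symm (k, 0)) = (i' k, 0))
    (hΨ : ∀ b, Ψ (q'' (q' b.1, b.2)) = q b) :
    ∃ H : ((A' × A'') × Q) ≃ₗ[ℝ] K × (B' × B''), IsSplitting f i q H ∧
      ∀ {na' nq' nk' nb' na'' nq'' nk'' nb'' nk nq : ℕ}
        (a' : Basis (Fin na') ℝ A') (e' : Basis (Fin nq') ℝ Q') (z' : Basis (Fin nk') ℝ K')
        (b' : Basis (Fin nb') ℝ B') (a'' : Basis (Fin na'') ℝ A'') (e'' : Basis (Fin nq'') ℝ Q'')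
        (z'' : Basis (Fin nk'') ℝ K'') (b'' : Basis (Fin nb'') ℝ B'') (z : Basis (Fin nk) ℝ K)
        (e : Basis (Fin nq) ℝ Q),
        H.orSign (prodBasis (prodBasis a' a'') e) (prodBasis z (prodBasis b' b'')) =
          (-1) ^ (nk'' * (na' + nk')) * H'.orSign (prodBasis a' e') (prodBasis z' b') *
            H''.orSign (prodBasis a'' e'') (prodBasis z'' (prodBasis e' b'')) *
            Ψ.orSign e'' e * Φ.orSign z (prodBasis z' z'') := by
  let t : A'' →ₗ[ℝ] A' :=
    LinearMap.fst ℝ A' Q' ∘ₗ H'.symm.toLinearMap ∘ₗ LinearMap.inr ℝ K' B' ∘ₗ φ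
  let l : K'' →ₗ[ℝ] K' :=
    -(LinearMap.fst ℝ K' B' ∘ₗ H'.toLinearMap ∘ₗ LinearMap.inl ℝ A' Q' ∘ₗ LinearMap.fst ℝ A' A'' ∘ₗ
      i ∘ₗ Φ.symm.toLinearMap ∘ₗ LinearMap.inr ℝ K' K'')
  let e₁ := (shear t).prodCongr Ψ.symm
  let e₂ := LinearEquiv.prodAssoc ℝ A' A'' Q''
  let e₃ := (LinearEquiv.refl ℝ A').prodCongr H''
  let e₄ := swapMid A' K'' (Q' × B'')
  let e₅ := (LinearEquiv.refl ℝ K'').prodCongr ((LinearEquiv.prodAssoc ℝ A' Q' B'').symm ≪≫ₗ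
    H'.prodCongr (LinearEquiv.refl ℝ B'') ≪≫ₗ LinearEquiv.prodAssoc ℝ K' B' B'')
  let e₆ := swapMid K'' K' (B' × B'')
  let e₇ := (LinearEquiv.prodAssoc ℝ K' K'' (B' × B'')).symm
  let e₈ := (shear l ≪≫ₗ Φ.symm).prodCongr (LinearEquiv.refl ℝ (B' × B''))
  have ht (a : A'') : H' (t a, (g a).1) = (0, φ a) := by
    rw [← LinearEquiv.eq_symm_apply]
    ext
    · rfl
    · rw [hg]
      have := h'.quot_apply (H'.symm (0, φ a))
      simpa using this
  refine ⟨e₁ ≪≫ₗ e₂ ≪≫ₗ e₃ ≪≫ₗ e₄ ≪≫ₗ e₅ ≪≫ₗ e₆ ≪≫ₗ e₇ ≪≫ₗ e₈, ?_, ?_⟩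
  · have happ (a' : A') (a'' : A'') (y : Q) :
        (e₁ ≪≫ₗ e₂ ≪≫ₗ e₃ ≪≫ₗ e₄ ≪≫ₗ e₅ ≪≫ₗ e₆ ≪≫ₗ e₇ ≪≫ₗ e₈) ((a', a''), y) =
          (Φ.symm ((H' (a' + t a'', (H'' (a'', Ψ.symm y)).2.1)).1 + l (H'' (a'', Ψ.symm y)).1,
              (H'' (a'', Ψ.symm y)).1),
            ((H' (a' + t a'', (H'' (a'', Ψ.symm y)).2.1)).2, (H'' (a'', Ψ.symm y)).2.2)) := rfl
    have happ0 (a' : A') (a'' : A'') :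
        (e₁ ≪≫ₗ e₂ ≪≫ₗ e₃ ≪≫ₗ e₄ ≪≫ₗ e₅ ≪≫ₗ e₆ ≪≫ₗ e₇ ≪≫ₗ e₈) ((a', a''), 0) =
          (Φ.symm ((H' (a', 0)).1 + l (H'' (a'', 0)).1, (H'' (a'', 0)).1), f (a', a'')) := by
      have h1 : H' (a' + t a'', (g a'').1) = H' (a', 0) + (0, φ a'') := by
        rw [← ht, ← map_add]; simp
      rw [happ, map_zero, h''.apply_fst, h1, hf]
      simp [h'.apply_fst]
    constructor
    · intro k
      obtain ⟨⟨k', k''⟩, rfl⟩ := Φ.symm.surjective k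
      have hk : i (Φ.symm (k', k'')) = i (Φ.symm (k', 0)) + i (Φ.symm (0, k'')) := by
        rw [← map_add, ← map_add]; simp
      have h0 : H'' ((i (Φ.symm (k', k''))).2, 0) = (k'', 0) := by
        rw [hΦ, h''.apply_ker]; simp
      have h1 : (H' ((i (Φ.symm (k', k''))).1, 0)).1 = k' - l k'' := by
        have : l k'' = -(H' ((i (Φ.symm (0, k''))).1, 0)).1 := rfl
        rw [this, hk, hΦ', sub_neg_eq_add]
        have : (((i' k', 0) + i (Φ.symm (0, k'')) : A' × A'').1, (0 : Q')) =
          (i' k', 0) + ((i (Φ.symm (0, k''))).1, 0) := by simp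
        rw [this, map_add, h'.apply_ker]
        rfl
      rw [show i (Φ.symm (k', k'')) = ((i (Φ.symm (k', k''))).1, (i (Φ.symm (k', k''))).2) from rfl,
        happ0, h0, h1]
      simp [hi]
    · rintro ⟨⟨a', a''⟩, y⟩
      rw [happ, ← hΨ]
      simp only [h'.quot_apply]
      rw [show ((H'' (a'', Ψ.symm y)).2.1, (H'' (a'', Ψ.symm y)).2.2) =
        (H'' (a'', Ψ.symm y)).2 from rfl, h''.quot_apply]
      simp
    · rintro ⟨a', a''⟩
      rw [happ0]
  · intro na' nq' nk' nb' na'' nq'' nk'' nb'' nk nq a' e' z' b' a'' e'' z'' b'' z e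
    refine (LinearEquiv.orSign_trans_of
      (LinearEquiv.orSign_prodCongr_of (orSign_shear t a' a'') (Ψ.orSign_symm e'' e)) <|
      LinearEquiv.orSign_trans_of (LinearEquiv.orSign_prodAssoc a' a'' e'') <|
      LinearEquiv.orSign_trans_of (LinearEquiv.orSign_prodCongr_of
        (LinearEquiv.orSign_refl_self a')
        (rfl : _ = H''.orSign (prodBasis a'' e'') (prodBasis z'' (prodBasis e' b'')))) <|
      LinearEquiv.orSign_trans_of (orSign_swapMid a' z'' (prodBasis e' b'')) <|
      LinearEquiv.orSign_trans_of (LinearEquiv.orSign_prodCongr_of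
        (LinearEquiv.orSign_refl_self z'') <|
        LinearEquiv.orSign_trans_of
          ((LinearEquiv.orSign_symm _ _ _).trans (LinearEquiv.orSign_prodAssoc a' e' b'')) <|
        LinearEquiv.orSign_trans_of
          (LinearEquiv.orSign_prodCongr_of
            (rfl : _ = H'.orSign (prodBasis a' e') (prodBasis z' b'))
            (LinearEquiv.orSign_refl_self b''))
          (LinearEquiv.orSign_prodAssoc z' b' b'')) <|
      LinearEquiv.orSign_trans_of (orSign_swapMid z'' z' (prodBasis b' b'')) <|
      LinearEquiv.orSign_trans_of ((LinearEquiv.orSign_symm _ _ _).trans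
        (LinearEquiv.orSign_prodAssoc z' z'' (prodBasis b' b''))) <|
      LinearEquiv.orSign_prodCongr_of
        (LinearEquiv.orSign_trans_of (orSign_shear l z' z'')
          (Φ.orSign_symm z (prodBasis z' z'')))
        (LinearEquiv.orSign_refl_self (prodBasis b' b''))).trans ?_
    simp only [one_mul, mul_one]
    rw [mul_add, pow_add, Nat.mul_comm na' nk'']
    ac_rfl

end Split

section Composite

variable {A₁ B₁ C₁ A₂ B₂ C₂ : Type*}
  [AddCommGroup A₁] [Module ℝ A₁] [AddCommGroup B₁] [Module ℝ B₁]
  [AddCommGroup C₁] [Module ℝ C₁] [AddCommGroup A₂] [Module ℝ A₂]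
  [AddCommGroup B₂] [Module ℝ B₂] [AddCommGroup C₂] [Module ℝ C₂]
  {na₁ nb₁ nc₁ na₂ nb₂ nc₂ nk ncok : ℕ}

theorem IsCompositeOrientation.exists_splitting {f : A₂ →ₗ[ℝ] B₁ × B₂}
    {μ₁ : Orientation ℝ (B₁ × (A₁ × C₁)) (Fin (nb₁ + (na₁ + nc₁)))}
    {μ₂ : Orientation ℝ (B₂ × (A₂ × C₂)) (Fin (nb₂ + (na₂ + nc₂)))}
    {ν : Orientation ℝ
      (((B₁ × B₂) ⧸ LinearMap.range f) × (A₁ × (C₁ × (C₂ × ↥(LinearMap.ker f)))))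
      (Fin (ncok + (na₁ + (nc₁ + (nc₂ + nk)))))}
    (h : IsCompositeOrientation f μ₁ μ₂ ν) :
    ∃ (d : ℕ) (H : (A₂ × ((B₁ × B₂) ⧸ LinearMap.range f)) ≃ₗ[ℝ]
        ↥(LinearMap.ker f) × (B₁ × B₂)),
      IsSplitting f (LinearMap.ker f).subtype (LinearMap.range f).mkQ H ∧
      d + ncok = nb₁ + nb₂ ∧ nk + d = na₂ ∧
      ∀ (a₁ : Basis (Fin na₁) ℝ A₁) (b₁ : Basis (Fin nb₁) ℝ B₁)
        (c₁ : Basis (Fin nc₁) ℝ C₁) (a₂ : Basis (Fin na₂) ℝ A₂)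
        (b₂ : Basis (Fin nb₂) ℝ B₂) (c₂ : Basis (Fin nc₂) ℝ C₂)
        (e : Basis (Fin ncok) ℝ ((B₁ × B₂) ⧸ LinearMap.range f))
        (z : Basis (Fin nk) ℝ ↥(LinearMap.ker f)),
        ν.basisSign (prodBasis e (prodBasis a₁ (prodBasis c₁ (prodBasis c₂ z)))) =
          (-1) ^ (nb₁ * na₂ + nb₁ * nc₂ + na₂ * nc₂ + d * (d - 1) / 2) *
            μ₁.basisSign (prodBasis b₁ (prodBasis a₁ c₁)) *
            μ₂.basisSign (prodBasis b₂ (prodBasis a₂ c₂)) *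
            H.orSign (prodBasis a₂ e) (prodBasis z (prodBasis b₁ b₂)) := by
  obtain ⟨a₁, b₁, c₁, a₂, b₂, c₂, dl, e, z, F, G, hFi, hGi, hF₁, hF₂, hG₁, hG₂, rfl, rfl,
    hF, hG, hν⟩ := h
  generalize finrank ℝ ↥(LinearMap.range f) = d at *
  have hFs : F.orSign (prodBasis dl e) (prodBasis b₁ b₂) = 1 := by
    have := Orientation.basisSign_reindex
      ((prodBasis dl e).map F).orientation ((prodBasis dl e).map F) hFi (prodBasis b₁ b₂)
    rw [hF, Orientation.basisSign_self, Orientation.basisSign_self, one_mul] at this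
    exact this.symm
  have hGs : G.orSign (prodBasis z dl) a₂ = 1 := by
    have := Orientation.basisSign_reindex
      ((prodBasis z dl).map G).orientation ((prodBasis z dl).map G) hGi a₂
    rw [hG, Orientation.basisSign_self, Orientation.basisSign_self, one_mul] at this
    exact this.symm
  let H := (G.symm.prodCongr (LinearEquiv.refl ℝ ((B₁ × B₂) ⧸ LinearMap.range f))) ≪≫ₗ
    LinearEquiv.prodAssoc ℝ (LinearMap.ker f) (LinearMap.range f)
      ((B₁ × B₂) ⧸ LinearMap.range f) ≪≫ₗ
    (LinearEquiv.refl ℝ (LinearMap.ker f)).prodCongr F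
  have happ (x) : H x = ((G.symm x.1).1, F ((G.symm x.1).2, x.2)) := rfl
  have hFsplit (x) : F x = x.1 + F (0, x.2) := by rw [← hF₁, ← map_add]; simp
  have hGsplit (x) : G x = x.1 + G (0, x.2) := by rw [← hG₁, ← map_add]; simp
  have hs : H.orSign (prodBasis a₂ e) (prodBasis z (prodBasis b₁ b₂)) = 1 :=
    (LinearEquiv.orSign_trans_of
      (LinearEquiv.orSign_prodCongr_of ((G.orSign_symm _ _).trans hGs)
        (LinearEquiv.orSign_refl_self e))
      (LinearEquiv.orSign_trans_of (LinearEquiv.orSign_prodAssoc z dl e)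
        (LinearEquiv.orSign_prodCongr_of (LinearEquiv.orSign_refl_self z) hFs))).trans (by simp)
  refine ⟨d, H, ⟨?_, ?_, ?_⟩, hFi, hGi, ?_⟩
  · intro k
    have : G.symm (k : A₂) = (k, 0) := by rw [LinearEquiv.symm_apply_eq, hG₁]
    rw [happ]
    simp [this]
  · intro x
    rw [happ, hFsplit, map_add, hF₂]
    simp
  · intro a
    obtain ⟨x, rfl⟩ := G.surjective a
    rw [happ, hGsplit]
    have : f (x.1 : A₂) = 0 := x.1.2
    rw [map_add f, this, hG₂, ← hGsplit]
    simp [hF₁]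
  · intro a₁' b₁' c₁' a₂' b₂' c₂' e' z'
    have hνs : ν.basisSign (prodBasis e (prodBasis a₁ (prodBasis c₁ (prodBasis c₂ z)))) =
        (-1) ^ (nb₁ * na₂ + nb₁ * nc₂ + na₂ * nc₂ + d * (d - 1) / 2) := by
      rw [hν]
      split_ifs with hpar
      · rw [Orientation.basisSign_self, (Nat.even_iff.2 hpar).neg_one_pow]
      · rw [Orientation.basisSign_neg, Orientation.basisSign_self,
          (Nat.not_even_iff_odd.1 (mt Nat.even_iff.1 hpar)).neg_one_pow]
    rw [ν.basisSign_mul_relSign (prodBasis e (prodBasis a₁ (prodBasis c₁ (prodBasis c₂ z)))), hνs,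
      Orientation.basisSign_mul_relSign _ (prodBasis b₁ (prodBasis a₁ c₁)),
      Orientation.basisSign_mul_relSign _ (prodBasis b₂ (prodBasis a₂ c₂)),
      H.orSign_change (prodBasis a₂ e) (prodBasis z (prodBasis b₁ b₂)), hs]
    simp only [relSign_prodBasis, Orientation.basisSign_self, one_mul, mul_one]
    have hb₁ := Int.units_mul_self (relSign b₁ b₁')
    have hb₂ := Int.units_mul_self (relSign b₂ b₂')
    have ha₂ := Int.units_mul_self (relSign a₂ a₂')
    generalize relSign b₁ b₁' = s₁ at *
    generalize relSign b₂ b₂' = s₂ at *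
    generalize relSign a₂ a₂' = s₃ at *
    calc _ = (-1) ^ (nb₁ * na₂ + nb₁ * nc₂ + na₂ * nc₂ + d * (d - 1) / 2) *
          (relSign e e' * (relSign a₁ a₁' * (relSign c₁ c₁' * (relSign c₂ c₂' * relSign z z')))) *
          (s₁ * s₁) * (s₂ * s₂) * (s₃ * s₃) := by rw [hb₁, hb₂, ha₂]; simp
      _ = _ := by ac_rfl

/-- The composite orientation determines bases of all the spaces involved. -/
theorem IsCompositeOrientation.nonempty_bases {f : A₂ →ₗ[ℝ] B₁ × B₂}
    {μ₁ : Orientation ℝ (B₁ × (A₁ × C₁)) (Fin (nb₁ + (na₁ + nc₁)))}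
    {μ₂ : Orientation ℝ (B₂ × (A₂ × C₂)) (Fin (nb₂ + (na₂ + nc₂)))}
    {ν : Orientation ℝ
      (((B₁ × B₂) ⧸ LinearMap.range f) × (A₁ × (C₁ × (C₂ × ↥(LinearMap.ker f)))))
      (Fin (ncok + (na₁ + (nc₁ + (nc₂ + nk)))))}
    (h : IsCompositeOrientation f μ₁ μ₂ ν) :
    (Nonempty (Basis (Fin na₁) ℝ A₁) ∧ Nonempty (Basis (Fin nb₁) ℝ B₁) ∧
      Nonempty (Basis (Fin nc₁) ℝ C₁)) ∧
    (Nonempty (Basis (Fin na₂) ℝ A₂) ∧ Nonempty (Basis (Fin nb₂) ℝ B₂) ∧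
      Nonempty (Basis (Fin nc₂) ℝ C₂)) ∧
    Nonempty (Basis (Fin ncok) ℝ ((B₁ × B₂) ⧸ LinearMap.range f)) ∧
    Nonempty (Basis (Fin nk) ℝ ↥(LinearMap.ker f)) := by
  obtain ⟨a₁, b₁, c₁, a₂, b₂, c₂, -, e, z, -⟩ := h
  exact ⟨⟨⟨a₁⟩, ⟨b₁⟩, ⟨c₁⟩⟩, ⟨⟨a₂⟩, ⟨b₂⟩, ⟨c₂⟩⟩, ⟨e⟩, ⟨z⟩⟩

end Composite

section Assoc

variable {A A' B B' K Q Q' W X Y C₁ C₂ C₃ K' K'' : Type*}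
  [AddCommGroup A] [Module ℝ A] [AddCommGroup A'] [Module ℝ A']
  [AddCommGroup B] [Module ℝ B] [AddCommGroup B'] [Module ℝ B']
  [AddCommGroup K] [Module ℝ K] [AddCommGroup Q] [Module ℝ Q] [AddCommGroup Q'] [Module ℝ Q']
  [AddCommGroup W] [Module ℝ W] [AddCommGroup X] [Module ℝ X] [AddCommGroup Y] [Module ℝ Y]
  [AddCommGroup C₁] [Module ℝ C₁] [AddCommGroup C₂] [Module ℝ C₂]
  [AddCommGroup C₃] [Module ℝ C₃] [AddCommGroup K'] [Module ℝ K'] [AddCommGroup K''] [Module ℝ K'']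

theorem IsSplitting.exists_conj {f : A →ₗ[ℝ] B} {i : K →ₗ[ℝ] A} {q : B →ₗ[ℝ] Q}
    {H : (A × Q) ≃ₗ[ℝ] K × B} (h : IsSplitting f i q H) (α : A' ≃ₗ[ℝ] A) (β : B ≃ₗ[ℝ] B')
    {f' : A' →ₗ[ℝ] B'} {i' : K →ₗ[ℝ] A'} {q' : B' →ₗ[ℝ] Q} (hf : ∀ a, f' a = β (f (α a)))
    (hi : ∀ k, α (i' k) = i k) (hq : ∀ b, q' (β b) = q b) :
    ∃ H' : (A' × Q) ≃ₗ[ℝ] K × B', IsSplitting f' i' q' H' ∧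
      ∀ {na na' nb nb' nk nq : ℕ} (a : Basis (Fin na) ℝ A) (a' : Basis (Fin na') ℝ A')
        (b : Basis (Fin nb) ℝ B) (b' : Basis (Fin nb') ℝ B') (z : Basis (Fin nk) ℝ K)
        (e : Basis (Fin nq) ℝ Q),
        H'.orSign (prodBasis a' e) (prodBasis z b') =
          α.orSign a' a * H.orSign (prodBasis a e) (prodBasis z b) * β.orSign b b' := by
  let H' := α.prodCongr (LinearEquiv.refl ℝ Q) ≪≫ₗ H ≪≫ₗ (LinearEquiv.refl ℝ K).prodCongr β
  have happ (x) : H' x = ((H (α x.1, x.2)).1, β (H (α x.1, x.2)).2) := rfl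
  refine ⟨H', ⟨fun k => ?_, fun x => ?_, fun a => ?_⟩, fun a a' b b' z e => ?_⟩
  · rw [happ]
    simp [hi, h.apply_ker]
  · rw [happ, hq, h.quot_apply]
  · rw [happ, hf, h.apply_fst]
  · refine (LinearEquiv.orSign_trans_of
      (LinearEquiv.orSign_prodCongr_of (rfl : _ = α.orSign a' a) (LinearEquiv.orSign_refl_self e))
      (LinearEquiv.orSign_trans_of (rfl : _ = H.orSign (prodBasis a e) (prodBasis z b))
        (LinearEquiv.orSign_prodCongr_of (LinearEquiv.orSign_refl_self z)
          (rfl : _ = β.orSign b b')))).trans ?_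
    simp only [one_mul, mul_one, mul_assoc]

theorem LinearEquiv.exists_eq_prodCongr (T : (Q × X) ≃ₗ[ℝ] Q' × Y) (t : X ≃ₗ[ℝ] Y)
    (r : W →ₗ[ℝ] Q) (hr : Function.Surjective r) (s : W →ₗ[ℝ] Q') (hs : Function.Surjective s)
    (hT : ∀ w x, T (r w, x) = (s w, t x)) :
    ∃ Ψ : Q ≃ₗ[ℝ] Q', (∀ w, Ψ (r w) = s w) ∧ T = Ψ.prodCongr t := by
  let ψ : Q →ₗ[ℝ] Q' := LinearMap.fst ℝ Q' Y ∘ₗ T.toLinearMap ∘ₗ LinearMap.inl ℝ Q X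
  have hψ (w) : ψ (r w) = s w := congrArg Prod.fst (hT w 0)
  have hinj : Function.Injective ψ := by
    rw [injective_iff_map_eq_zero]
    intro x hx
    obtain ⟨w, rfl⟩ := hr x
    have h := hT w 0
    rw [← hψ, hx, map_zero, ← Prod.zero_eq_mk, T.map_eq_zero_iff] at h
    exact congrArg Prod.fst h
  have hsurj : Function.Surjective ψ := fun y => by
    obtain ⟨w, rfl⟩ := hs y
    exact ⟨r w, hψ w⟩
  refine ⟨LinearEquiv.ofBijective ψ ⟨hinj, hsurj⟩, hψ, ?_⟩
  apply LinearEquiv.ext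
  rintro ⟨x, y⟩
  obtain ⟨w, rfl⟩ := hr x
  rw [hT, ← hψ]
  rfl

variable (C₁ C₂ C₃) in
/-- The shuffle `(C₁ ⊕ C₂ ⊕ K') ⊕ (C₃ ⊕ K'') ≅ C₁ ⊕ C₂ ⊕ C₃ ⊕ K` induced by `Φ`. -/
def leftShuffle (Φ : K ≃ₗ[ℝ] K' × K'') :
    ((C₁ × (C₂ × K')) × (C₃ × K'')) ≃ₗ[ℝ] C₁ × (C₂ × (C₃ × K)) :=
  LinearEquiv.prodAssoc ℝ C₁ (C₂ × K') (C₃ × K'') ≪≫ₗ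
    (LinearEquiv.refl ℝ C₁).prodCongr (LinearEquiv.prodAssoc ℝ C₂ K' (C₃ × K'') ≪≫ₗ
      (LinearEquiv.refl ℝ C₂).prodCongr (swapMid K' C₃ K'' ≪≫ₗ
        (LinearEquiv.refl ℝ C₃).prodCongr Φ.symm))

variable (C₁ C₂ C₃) in
/-- The shuffle `C₁ ⊕ ((C₂ ⊕ C₃ ⊕ K') ⊕ K'') ≅ C₁ ⊕ C₂ ⊕ C₃ ⊕ K` induced by `Φ`. -/
def rightShuffle (Φ : K ≃ₗ[ℝ] K' × K'') :
    (C₁ × ((C₂ × (C₃ × K')) × K'')) ≃ₗ[ℝ] C₁ × (C₂ × (C₃ × K)) :=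
  (LinearEquiv.refl ℝ C₁).prodCongr (LinearEquiv.prodAssoc ℝ C₂ (C₃ × K') K'' ≪≫ₗ
    (LinearEquiv.refl ℝ C₂).prodCongr (LinearEquiv.prodAssoc ℝ C₃ K' K'' ≪≫ₗ
      (LinearEquiv.refl ℝ C₃).prodCongr Φ.symm))

variable {nc₁ nc₂ nc₃ nk nk' nk'' : ℕ}

theorem orSign_leftShuffle (Φ : K ≃ₗ[ℝ] K' × K'') (c₁ : Basis (Fin nc₁) ℝ C₁)
    (c₂ : Basis (Fin nc₂) ℝ C₂) (c₃ : Basis (Fin nc₃) ℝ C₃) (z : Basis (Fin nk) ℝ K)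
    (z' : Basis (Fin nk') ℝ K') (z'' : Basis (Fin nk'') ℝ K'') :
    (leftShuffle C₁ C₂ C₃ Φ).orSign
        (prodBasis (prodBasis c₁ (prodBasis c₂ z')) (prodBasis c₃ z''))
        (prodBasis c₁ (prodBasis c₂ (prodBasis c₃ z))) =
      (-1) ^ (nk' * nc₃) * Φ.orSign z (prodBasis z' z'') := by
  refine (LinearEquiv.orSign_trans_of
    (LinearEquiv.orSign_prodAssoc c₁ (prodBasis c₂ z') (prodBasis c₃ z'')) <|
    LinearEquiv.orSign_prodCongr_of (LinearEquiv.orSign_refl_self c₁) <|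
    LinearEquiv.orSign_trans_of (LinearEquiv.orSign_prodAssoc c₂ z' (prodBasis c₃ z'')) <|
    LinearEquiv.orSign_prodCongr_of (LinearEquiv.orSign_refl_self c₂) <|
    LinearEquiv.orSign_trans_of (orSign_swapMid z' c₃ z'') <|
    LinearEquiv.orSign_prodCongr_of (LinearEquiv.orSign_refl_self c₃)
      (Φ.orSign_symm z (prodBasis z' z''))).trans ?_
  simp only [one_mul]

theorem orSign_rightShuffle (Φ : K ≃ₗ[ℝ] K' × K'') (c₁ : Basis (Fin nc₁) ℝ C₁)
    (c₂ : Basis (Fin nc₂) ℝ C₂) (c₃ : Basis (Fin nc₃) ℝ C₃) (z : Basis (Fin nk) ℝ K)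
    (z' : Basis (Fin nk') ℝ K') (z'' : Basis (Fin nk'') ℝ K'') :
    (rightShuffle C₁ C₂ C₃ Φ).orSign
        (prodBasis c₁ (prodBasis (prodBasis c₂ (prodBasis c₃ z')) z''))
        (prodBasis c₁ (prodBasis c₂ (prodBasis c₃ z))) =
      Φ.orSign z (prodBasis z' z'') := by
  refine (LinearEquiv.orSign_prodCongr_of (LinearEquiv.orSign_refl_self c₁) <|
    LinearEquiv.orSign_trans_of (LinearEquiv.orSign_prodAssoc c₂ (prodBasis c₃ z') z'') <|
    LinearEquiv.orSign_prodCongr_of (LinearEquiv.orSign_refl_self c₂) <|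
    LinearEquiv.orSign_trans_of (LinearEquiv.orSign_prodAssoc c₃ z' z'') <|
    LinearEquiv.orSign_prodCongr_of (LinearEquiv.orSign_refl_self c₃)
      (Φ.orSign_symm z (prodBasis z' z''))).trans ?_
  simp only [one_mul]

theorem triangle_add (m n : ℕ) :
    (m + n) * (m + n - 1) / 2 = m * (m - 1) / 2 + n * (n - 1) / 2 + m * n := by
  simp only [← Nat.choose_two_right]
  induction n with
  | zero => simp
  | succ n ih =>
    rw [← Nat.add_assoc, Nat.choose_succ_succ' (m + n), Nat.choose_succ_succ' n, ih]
    simp only [Nat.choose_one_right]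
    ring

end Assoc

theorem associativity_parity {na₂ nb₁ nc₂ na₃ nb₂ nb₃ nc₃ nk₁₂ ncok₁₂ nk₂₃ ncok₂₃ nkL nkR
      d₁₂ d₂₃ dL dR : ℕ}
    (h₁₂ : d₁₂ + ncok₁₂ = nb₁ + nb₂) (h₁₂' : nk₁₂ + d₁₂ = na₂)
    (h₂₃ : d₂₃ + ncok₂₃ = nb₂ + nb₃) (h₂₃' : nk₂₃ + d₂₃ = na₃)
    (hL : nkL + dL = na₃) (hR : nkR + dR = na₂) (hk : nk₁₂ + nkL = nk₂₃ + nkR) :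
    (-1 : ℤˣ) ^ (ncok₁₂ * na₃ + ncok₁₂ * nc₃ + na₃ * nc₃ + dL * (dL - 1) / 2) *
        (-1) ^ (nb₁ * na₂ + nb₁ * nc₂ + na₂ * nc₂ + d₁₂ * (d₁₂ - 1) / 2) *
        (-1) ^ (nk₁₂ * nc₃) * (-1) ^ (nkL * (na₂ + nk₁₂)) =
      (-1) ^ (nb₁ * na₂ + nb₁ * (nc₂ + (nc₃ + nk₂₃)) + na₂ * (nc₂ + (nc₃ + nk₂₃)) +
          dR * (dR - 1) / 2) *
        (-1) ^ (nb₂ * na₃ + nb₂ * nc₃ + na₃ * nc₃ + d₂₃ * (d₂₃ - 1) / 2) *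
        (-1) ^ (nb₁ * ncok₂₃) * (-1) ^ (nkR * (na₃ + nk₂₃)) *
        (-1) ^ (na₂ * na₃) * (-1) ^ ((nb₂ + nb₃) * nb₁) := by
  have hd : d₁₂ + dL = d₂₃ + dR := by omega
  have hD := triangle_add d₁₂ dL
  rw [hd, triangle_add] at hD
  simp only [← pow_add]
  apply negOneUnit_pow_congr
  generalize dL * (dL - 1) / 2 = tL at *
  generalize dR * (dR - 1) / 2 = tR at *
  generalize d₁₂ * (d₁₂ - 1) / 2 = t₁₂ at *
  generalize d₂₃ * (d₂₃ - 1) / 2 = t₂₃ at *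
  have cast {m n : ℕ} (h : m = n) : (m : ZMod 2) = n := congrArg _ h
  have h1 := cast h₁₂
  have h2 := cast h₁₂'
  have h3 := cast h₂₃
  have h4 := cast h₂₃'
  have h5 := cast hL
  have h6 := cast hR
  have h7 := cast hD
  have h8 := cast hd
  have h9 := cast hk
  push_cast at *
  have e1 : (ncok₁₂ : ZMod 2) = nb₁ + nb₂ - d₁₂ := by linear_combination h1
  have e3 : (ncok₂₃ : ZMod 2) = nb₂ + nb₃ - d₂₃ := by linear_combination h3
  have e4 : (nk₂₃ : ZMod 2) = na₃ - d₂₃ := by linear_combination h4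
  have e2 : (nk₁₂ : ZMod 2) = na₂ - d₁₂ := by linear_combination h2
  have e5 : (nkL : ZMod 2) = na₃ - dL := by linear_combination h5
  have e6 : (nkR : ZMod 2) = na₂ - dR := by linear_combination h6
  have e8 : (dL : ZMod 2) = d₂₃ + dR - d₁₂ := by linear_combination h8
  have e7 : (tL : ZMod 2) = t₂₃ + tR + d₂₃ * dR - t₁₂ - d₁₂ * dL := by linear_combination -h7
  rw [e7, e1, e2, e3, e5, e6, e4, e8]
  ring_nf
  reduce_mod_char

theorem units_mul_eq_of_parity {pL p₁₂ t cL pR p₂₃ t' cR u u' m₁ m₂ m₃ h₁₂ hL h₂₃ hR ψL φL ψR φR : ℤˣ}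
    (hp : pL * p₁₂ * t * cL = pR * p₂₃ * t' * cR * u * u')
    (hs : cL * h₁₂ * hL * ψL * φL = u * (cR * h₂₃ * (hR * t') * ψR * φR) * u') :
    pL * (p₁₂ * m₁ * m₂ * h₁₂) * m₃ * hL * (ψL * (t * φL) * (ψR * φR)) =
      pR * m₁ * (p₂₃ * m₂ * m₃ * h₂₃) * hR := by
  calc _ = (pL * p₁₂ * t * cL) * (cL * h₁₂ * hL * ψL * φL) * (m₁ * m₂ * m₃ * ψR * φR) := by
        rw [← mul_one (pL * _ * _ * _ * _), ← Int.units_mul_self cL]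
        ac_rfl
    _ = pR * m₁ * (p₂₃ * m₂ * m₃ * h₂₃) * hR * (t' * t') * (cR * cR) * (u * u) * (u' * u') *
          (ψR * ψR) * (φR * φR) := by
        rw [hp, hs]
        ac_rfl
    _ = _ := by simp only [Int.units_mul_self, mul_one]

theorem IsSplitting.orSign_assoc {A₂ A₃ B₁ B₂ B₃ : Type*}
    [AddCommGroup A₂] [Module ℝ A₂] [AddCommGroup A₃] [Module ℝ A₃]
    [AddCommGroup B₁] [Module ℝ B₁] [AddCommGroup B₂] [Module ℝ B₂]
    [AddCommGroup B₃] [Module ℝ B₃]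
    {na₂ na₃ nb₁ nb₂ nb₃ nk₁₂ ncok₁₂ nk₂₃ ncok₂₃ nkL ncokL nkR ncokR nk ncok : ℕ}
    {f₁₂ : A₂ →ₗ[ℝ] B₁ × B₂} {f₂₃ : A₃ →ₗ[ℝ] B₂ × B₃} {f : A₂ × A₃ →ₗ[ℝ] B₁ × B₂ × B₃}
    (hf : ∀ p : A₂ × A₃,
      f p = ((f₁₂ p.1).1, ((f₁₂ p.1).2 + (f₂₃ p.2).1, (f₂₃ p.2).2)))
    {g : A₃ →ₗ[ℝ] ((B₁ × B₂) ⧸ LinearMap.range f₁₂) × B₃}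
    (hg : ∀ a : A₃,
      g a = (Submodule.mkQ (LinearMap.range f₁₂) (0, (f₂₃ a).1), (f₂₃ a).2))
    {g' : A₂ →ₗ[ℝ] B₁ × ((B₂ × B₃) ⧸ LinearMap.range f₂₃)}
    (hg' : ∀ a : A₂,
      g' a = ((f₁₂ a).1, Submodule.mkQ (LinearMap.range f₂₃) ((f₁₂ a).2, 0)))
    {H₁₂ : (A₂ × ((B₁ × B₂) ⧸ LinearMap.range f₁₂)) ≃ₗ[ℝ] LinearMap.ker f₁₂ × (B₁ × B₂)}
    (s₁₂ : IsSplitting f₁₂ (LinearMap.ker f₁₂).subtype (LinearMap.range f₁₂).mkQ H₁₂)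
    {H₂₃ : (A₃ × ((B₂ × B₃) ⧸ LinearMap.range f₂₃)) ≃ₗ[ℝ] LinearMap.ker f₂₃ × (B₂ × B₃)}
    (s₂₃ : IsSplitting f₂₃ (LinearMap.ker f₂₃).subtype (LinearMap.range f₂₃).mkQ H₂₃)
    {HL : (A₃ × ((((B₁ × B₂) ⧸ LinearMap.range f₁₂) × B₃) ⧸ LinearMap.range g)) ≃ₗ[ℝ]
      LinearMap.ker g × (((B₁ × B₂) ⧸ LinearMap.range f₁₂) × B₃)}
    (sL : IsSplitting g (LinearMap.ker g).subtype (LinearMap.range g).mkQ HL)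
    {HR : (A₂ × ((B₁ × ((B₂ × B₃) ⧸ LinearMap.range f₂₃)) ⧸ LinearMap.range g')) ≃ₗ[ℝ]
      LinearMap.ker g' × (B₁ × ((B₂ × B₃) ⧸ LinearMap.range f₂₃))}
    (sR : IsSplitting g' (LinearMap.ker g').subtype (LinearMap.range g').mkQ HR)
    (ΦL : LinearMap.ker f ≃ₗ[ℝ] LinearMap.ker f₁₂ × LinearMap.ker g)
    (hΦL₁ : ∀ p : LinearMap.ker f, ((ΦL p).2 : A₃) = (p : A₂ × A₃).2)
    (hΦL₂ : ∀ p : LinearMap.ker f, (p : A₂ × A₃).2 = 0 →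
      ((ΦL p).1 : A₂) = (p : A₂ × A₃).1 ∧ (ΦL p).2 = 0)
    (ΦR : LinearMap.ker f ≃ₗ[ℝ] LinearMap.ker f₂₃ × LinearMap.ker g')
    (hΦR₁ : ∀ p : LinearMap.ker f, ((ΦR p).2 : A₂) = (p : A₂ × A₃).1)
    (hΦR₂ : ∀ p : LinearMap.ker f, (p : A₂ × A₃).1 = 0 →
      ((ΦR p).1 : A₃) = (p : A₂ × A₃).2 ∧ (ΦR p).2 = 0)
    (ΨL : ((((B₁ × B₂) ⧸ LinearMap.range f₁₂) × B₃) ⧸ LinearMap.range g) ≃ₗ[ℝ]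
      (B₁ × B₂ × B₃) ⧸ LinearMap.range f)
    (hΨL : ∀ w : B₁ × B₂ × B₃, ΨL ((LinearMap.range g).mkQ
      ((LinearMap.range f₁₂).mkQ (w.1, w.2.1), w.2.2)) = (LinearMap.range f).mkQ w)
    (ΨR : ((B₁ × ((B₂ × B₃) ⧸ LinearMap.range f₂₃)) ⧸ LinearMap.range g') ≃ₗ[ℝ]
      (B₁ × B₂ × B₃) ⧸ LinearMap.range f)
    (hΨR : ∀ w : B₁ × B₂ × B₃, ΨR ((LinearMap.range g').mkQ
      (w.1, (LinearMap.range f₂₃).mkQ w.2)) = (LinearMap.range f).mkQ w)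
    (a₂ : Basis (Fin na₂) ℝ A₂) (a₃ : Basis (Fin na₃) ℝ A₃) (b₁ : Basis (Fin nb₁) ℝ B₁)
    (b₂ : Basis (Fin nb₂) ℝ B₂) (b₃ : Basis (Fin nb₃) ℝ B₃)
    (e₁₂ : Basis (Fin ncok₁₂) ℝ ((B₁ × B₂) ⧸ LinearMap.range f₁₂))
    (z₁₂ : Basis (Fin nk₁₂) ℝ (LinearMap.ker f₁₂))
    (e₂₃ : Basis (Fin ncok₂₃) ℝ ((B₂ × B₃) ⧸ LinearMap.range f₂₃))
    (z₂₃ : Basis (Fin nk₂₃) ℝ (LinearMap.ker f₂₃))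
    (eL : Basis (Fin ncokL) ℝ ((((B₁ × B₂) ⧸ LinearMap.range f₁₂) × B₃) ⧸ LinearMap.range g))
    (zL : Basis (Fin nkL) ℝ (LinearMap.ker g))
    (eR : Basis (Fin ncokR) ℝ ((B₁ × ((B₂ × B₃) ⧸ LinearMap.range f₂₃)) ⧸ LinearMap.range g'))
    (zR : Basis (Fin nkR) ℝ (LinearMap.ker g'))
    (e : Basis (Fin ncok) ℝ ((B₁ × B₂ × B₃) ⧸ LinearMap.range f))
    (z : Basis (Fin nk) ℝ (LinearMap.ker f)) :
    (-1) ^ (nkL * (na₂ + nk₁₂)) * H₁₂.orSign (prodBasis a₂ e₁₂) (prodBasis z₁₂ (prodBasis b₁ b₂)) *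
        HL.orSign (prodBasis a₃ eL) (prodBasis zL (prodBasis e₁₂ b₃)) * ΨL.orSign eL e *
        ΦL.orSign z (prodBasis z₁₂ zL) =
      (-1) ^ (na₂ * na₃) *
        ((-1) ^ (nkR * (na₃ + nk₂₃)) *
          H₂₃.orSign (prodBasis a₃ e₂₃) (prodBasis z₂₃ (prodBasis b₂ b₃)) *
          (HR.orSign (prodBasis a₂ eR) (prodBasis zR (prodBasis b₁ e₂₃)) * (-1) ^ (nb₁ * ncok₂₃)) *
          ΨR.orSign eR e * ΦR.orSign z (prodBasis z₂₃ zR)) *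
        (-1) ^ ((nb₂ + nb₃) * nb₁) := by
  -- the left-hand splitting of `f`
  obtain ⟨ML, sML, hML⟩ := s₁₂.exists_compose sL
    (f := (LinearEquiv.prodAssoc ℝ B₁ B₂ B₃).symm.toLinearMap ∘ₗ f)
    (i := (LinearMap.ker f).subtype)
    (q := (LinearMap.range f).mkQ ∘ₗ (LinearEquiv.prodAssoc ℝ B₁ B₂ B₃).toLinearMap)
    (LinearMap.inr ℝ B₁ B₂ ∘ₗ LinearMap.fst ℝ B₂ B₃ ∘ₗ f₂₃)
    (fun x => by
      rw [LinearMap.comp_apply, hf, hg]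
      exact Prod.ext (Prod.ext (add_zero _).symm rfl) rfl) (fun a => by rw [hg]; rfl) ΦL ΨL
    (fun k => by simp) (fun k => (hΦL₁ k).symm)
    (fun k => by
      have h := hΦL₁ (ΦL.symm (k, 0))
      rw [LinearEquiv.apply_symm_apply] at h
      have h' := (hΦL₂ _ h.symm).1
      rw [LinearEquiv.apply_symm_apply] at h'
      exact Prod.ext h'.symm h.symm)
    (fun b => hΨL (b.1.1, b.1.2, b.2))
  obtain ⟨NL, sNL, hNLs⟩ := sML.exists_conj (LinearEquiv.refl ℝ (A₂ × A₃))
    (LinearEquiv.prodAssoc ℝ B₁ B₂ B₃) (f' := f) (i' := (LinearMap.ker f).subtype)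
    (q' := (LinearMap.range f).mkQ) (fun a => by simp) (fun k => rfl) (fun b => rfl)
  -- the right-hand splitting of `f`
  obtain ⟨HR', sR', hHR'⟩ := sR.exists_conj (LinearEquiv.refl ℝ A₂)
    (LinearEquiv.prodComm ℝ B₁ ((B₂ × B₃) ⧸ LinearMap.range f₂₃))
    (f' := (LinearEquiv.prodComm ℝ _ _).toLinearMap ∘ₗ g') (i' := (LinearMap.ker g').subtype)
    (q' := (LinearMap.range g').mkQ ∘ₗ (LinearEquiv.prodComm ℝ _ _).toLinearMap)
    (fun a => rfl) (fun k => rfl) (fun b => rfl)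
  let α := LinearEquiv.prodComm ℝ A₂ A₃
  let β := LinearEquiv.prodComm ℝ (B₂ × B₃) B₁
  obtain ⟨MR, sMR, hMR⟩ := s₂₃.exists_compose sR'
    (f := β.symm.toLinearMap ∘ₗ f ∘ₗ α.symm.toLinearMap)
    (i := α.toLinearMap ∘ₗ (LinearMap.ker f).subtype)
    (q := (LinearMap.range f).mkQ ∘ₗ β.toLinearMap)
    (LinearMap.inl ℝ B₂ B₃ ∘ₗ LinearMap.snd ℝ B₁ B₂ ∘ₗ f₁₂)
    (fun x => by simp [α, β, hf, hg', Prod.ext_iff, add_comm])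
    (fun a => by
      rw [LinearMap.comp_apply, hg']
      rfl) ΦR ΨR
    (fun k => by simp [α]) (fun k => (hΦR₁ k).symm)
    (fun k => by
      have h := hΦR₁ (ΦR.symm (k, 0))
      rw [LinearEquiv.apply_symm_apply] at h
      have h' := (hΦR₂ _ h.symm).1
      rw [LinearEquiv.apply_symm_apply] at h'
      exact Prod.ext h'.symm h.symm)
    (fun b => hΨR (b.2, b.1))
  obtain ⟨NR, sNR, hNRs⟩ := sMR.exists_conj α β (f' := f) (i' := (LinearMap.ker f).subtype)
    (q' := (LinearMap.range f).mkQ) (fun a => by simp) (fun k => rfl) (fun b => rfl)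
  -- comparison of the two splittings
  have hcmp := sNL.orSign_eq sNR (prodBasis a₂ a₃) e z (prodBasis b₁ (prodBasis b₂ b₃))
  rw [hNLs (prodBasis a₂ a₃) _ (prodBasis (prodBasis b₁ b₂) b₃),
    hML a₂ e₁₂ z₁₂ (prodBasis b₁ b₂) a₃ eL zL b₃,
    hNRs (prodBasis a₃ a₂) _ (prodBasis (prodBasis b₂ b₃) b₁),
    hMR a₃ e₂₃ z₂₃ (prodBasis b₂ b₃) a₂ eR zR b₁,
    hHR' a₂ a₂ (prodBasis b₁ e₂₃), LinearEquiv.orSign_refl_self, LinearEquiv.orSign_refl_self,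
    LinearEquiv.orSign_prodAssoc, LinearEquiv.orSign_prodComm, LinearEquiv.orSign_prodComm,
    LinearEquiv.orSign_prodComm, one_mul, one_mul, mul_one] at hcmp
  exact hcmp

/-- **Associativity of the composition of orientations.**  Given orientation data
`(Aᵢ, Bᵢ, Cᵢ, μᵢ)` for `i = 1, 2, 3` and maps `f₁₂ : A₂ → B₁ ⊕ B₂`, `f₂₃ : A₃ → B₂ ⊕ B₃`,
form `f : A₂ ⊕ A₃ → B₁ ⊕ B₂ ⊕ B₃`, `f₍₁₂,₃₎ = g : A₃ → coker f₁₂ ⊕ B₃` and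
`f₍₁,₂₃₎ = g' : A₂ → B₁ ⊕ coker f₂₃` as in the paper.  Then, under the canonical
isomorphisms `coker f₍₁₂,₃₎ ≅ coker f ≅ coker f₍₁,₂₃₎` induced by the quotient maps,
any kernel decompositions `ker f ≅ ker f₁₂ ⊕ ker f₍₁₂,₃₎` and
`ker f ≅ ker f₂₃ ⊕ ker f₍₁,₂₃₎` obtained from linear sections of the canonical short
exact sequences, and the shuffles reordering the `C`-summands, the two iterated composite
orientations agree as orientations of `coker f ⊕ A₁ ⊕ (C₁ ⊕ C₂ ⊕ C₃ ⊕ ker f)`. -/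
theorem composite_orientation_assoc
    {A₁ B₁ C₁ A₂ B₂ C₂ A₃ B₃ C₃ : Type*}
    [AddCommGroup A₁] [Module ℝ A₁] [AddCommGroup B₁] [Module ℝ B₁]
    [AddCommGroup C₁] [Module ℝ C₁] [AddCommGroup A₂] [Module ℝ A₂]
    [AddCommGroup B₂] [Module ℝ B₂] [AddCommGroup C₂] [Module ℝ C₂]
    [AddCommGroup A₃] [Module ℝ A₃] [AddCommGroup B₃] [Module ℝ B₃]
    [AddCommGroup C₃] [Module ℝ C₃]
    [FiniteDimensional ℝ A₁] [FiniteDimensional ℝ B₁] [FiniteDimensional ℝ C₁]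
    [FiniteDimensional ℝ A₂] [FiniteDimensional ℝ B₂] [FiniteDimensional ℝ C₂]
    [FiniteDimensional ℝ A₃] [FiniteDimensional ℝ B₃] [FiniteDimensional ℝ C₃]
    {na₁ nb₁ nc₁ na₂ nb₂ nc₂ na₃ nb₃ nc₃ : ℕ}
    {nk₁₂ ncok₁₂ nk₂₃ ncok₂₃ nkL ncokL nkR ncokR : ℕ}
    (f₁₂ : A₂ →ₗ[ℝ] B₁ × B₂) (f₂₃ : A₃ →ₗ[ℝ] B₂ × B₃)
    (f : A₂ × A₃ →ₗ[ℝ] B₁ × B₂ × B₃)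
    (hf : ∀ p : A₂ × A₃,
      f p = ((f₁₂ p.1).1, ((f₁₂ p.1).2 + (f₂₃ p.2).1, (f₂₃ p.2).2)))
    (g : A₃ →ₗ[ℝ] ((B₁ × B₂) ⧸ LinearMap.range f₁₂) × B₃)
    (hg : ∀ a : A₃,
      g a = (Submodule.mkQ (LinearMap.range f₁₂) (0, (f₂₃ a).1), (f₂₃ a).2))
    (g' : A₂ →ₗ[ℝ] B₁ × ((B₂ × B₃) ⧸ LinearMap.range f₂₃))
    (hg' : ∀ a : A₂,
      g' a = ((f₁₂ a).1, Submodule.mkQ (LinearMap.range f₂₃) ((f₁₂ a).2, 0)))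
    (μ₁ : Orientation ℝ (B₁ × (A₁ × C₁)) (Fin (nb₁ + (na₁ + nc₁))))
    (μ₂ : Orientation ℝ (B₂ × (A₂ × C₂)) (Fin (nb₂ + (na₂ + nc₂))))
    (μ₃ : Orientation ℝ (B₃ × (A₃ × C₃)) (Fin (nb₃ + (na₃ + nc₃))))
    (ν₁₂ : Orientation ℝ
      ((((B₁ × B₂) ⧸ LinearMap.range f₁₂)) × (A₁ × (C₁ × (C₂ × ↥(LinearMap.ker f₁₂)))))
      (Fin (ncok₁₂ + (na₁ + (nc₁ + (nc₂ + nk₁₂))))))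
    (ν₂₃ : Orientation ℝ
      ((((B₂ × B₃) ⧸ LinearMap.range f₂₃)) × (A₂ × (C₂ × (C₃ × ↥(LinearMap.ker f₂₃)))))
      (Fin (ncok₂₃ + (na₂ + (nc₂ + (nc₃ + nk₂₃))))))
    (νL : Orientation ℝ
      (((((B₁ × B₂) ⧸ LinearMap.range f₁₂) × B₃) ⧸ LinearMap.range g) ×
        (A₁ × ((C₁ × (C₂ × ↥(LinearMap.ker f₁₂))) × (C₃ × ↥(LinearMap.ker g)))))
      (Fin (ncokL + (na₁ + ((nc₁ + (nc₂ + nk₁₂)) + (nc₃ + nkL))))))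
    (νR : Orientation ℝ
      (((B₁ × ((B₂ × B₃) ⧸ LinearMap.range f₂₃)) ⧸ LinearMap.range g') ×
        (A₁ × (C₁ × ((C₂ × (C₃ × ↥(LinearMap.ker f₂₃))) × ↥(LinearMap.ker g')))))
      (Fin (ncokR + (na₁ + (nc₁ + ((nc₂ + (nc₃ + nk₂₃)) + nkR))))))
    (h₁₂ : IsCompositeOrientation f₁₂ μ₁ μ₂ ν₁₂)
    (h₂₃ : IsCompositeOrientation f₂₃ μ₂ μ₃ ν₂₃)
    (hL : IsCompositeOrientation g ν₁₂ μ₃ νL)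
    (hR : IsCompositeOrientation g' μ₁ ν₂₃ νR)
    -- a kernel decomposition `ker f ≅ ker f₁₂ ⊕ ker f₍₁₂,₃₎` obtained from a linear section
    (ΦL : ↥(LinearMap.ker f) ≃ₗ[ℝ] ↥(LinearMap.ker f₁₂) × ↥(LinearMap.ker g))
    (hΦL₁ : ∀ p : ↥(LinearMap.ker f), (((ΦL p).2 : A₃)) = (p : A₂ × A₃).2)
    (hΦL₂ : ∀ p : ↥(LinearMap.ker f), (p : A₂ × A₃).2 = 0 →
      (((ΦL p).1 : A₂)) = (p : A₂ × A₃).1 ∧ (ΦL p).2 = 0)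
    -- a kernel decomposition `ker f ≅ ker f₂₃ ⊕ ker f₍₁,₂₃₎` obtained from a linear section
    (ΦR : ↥(LinearMap.ker f) ≃ₗ[ℝ] ↥(LinearMap.ker f₂₃) × ↥(LinearMap.ker g'))
    (hΦR₁ : ∀ p : ↥(LinearMap.ker f), (((ΦR p).2 : A₂)) = (p : A₂ × A₃).1)
    (hΦR₂ : ∀ p : ↥(LinearMap.ker f), (p : A₂ × A₃).1 = 0 →
      (((ΦR p).1 : A₃)) = (p : A₂ × A₃).2 ∧ (ΦR p).2 = 0)
    -- the identification of the left-hand total space with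
    -- `coker f ⊕ A₁ ⊕ (C₁ ⊕ C₂ ⊕ C₃ ⊕ ker f)`, built from the canonical cokernel
    -- isomorphism, the kernel decomposition `ΦL` and the shuffle of the `C`-summands
    (TL : (((((B₁ × B₂) ⧸ LinearMap.range f₁₂) × B₃) ⧸ LinearMap.range g) ×
        (A₁ × ((C₁ × (C₂ × ↥(LinearMap.ker f₁₂))) × (C₃ × ↥(LinearMap.ker g))))) ≃ₗ[ℝ]
      (((B₁ × B₂ × B₃) ⧸ LinearMap.range f) ×
        (A₁ × (C₁ × (C₂ × (C₃ × ↥(LinearMap.ker f)))))))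
    (hTL : ∀ (w : B₁ × B₂ × B₃) (x₁ : A₁) (y₁ : C₁) (y₂ : C₂) (y₃ : C₃)
        (k : ↥(LinearMap.ker f₁₂)) (k' : ↥(LinearMap.ker g)),
      TL (Submodule.mkQ (LinearMap.range g)
            (Submodule.mkQ (LinearMap.range f₁₂) (w.1, w.2.1), w.2.2),
          (x₁, ((y₁, (y₂, k)), (y₃, k')))) =
        (Submodule.mkQ (LinearMap.range f) w,
          (x₁, (y₁, (y₂, (y₃, ΦL.symm (k, k')))))))
    -- the analogous identification of the right-hand total space
    (TR : (((B₁ × ((B₂ × B₃) ⧸ LinearMap.range f₂₃)) ⧸ LinearMap.range g') ×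
        (A₁ × (C₁ × ((C₂ × (C₃ × ↥(LinearMap.ker f₂₃))) × ↥(LinearMap.ker g'))))) ≃ₗ[ℝ]
      (((B₁ × B₂ × B₃) ⧸ LinearMap.range f) ×
        (A₁ × (C₁ × (C₂ × (C₃ × ↥(LinearMap.ker f)))))))
    (hTR : ∀ (w : B₁ × B₂ × B₃) (x₁ : A₁) (y₁ : C₁) (y₂ : C₂) (y₃ : C₃)
        (k : ↥(LinearMap.ker f₂₃)) (k' : ↥(LinearMap.ker g')),
      TR (Submodule.mkQ (LinearMap.range g')
            (w.1, Submodule.mkQ (LinearMap.range f₂₃) (w.2.1, w.2.2)),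
          (x₁, (y₁, ((y₂, (y₃, k)), k')))) =
        (Submodule.mkQ (LinearMap.range f) w,
          (x₁, (y₁, (y₂, (y₃, ΦR.symm (k, k')))))))
    (hNL : ncokL + (na₁ + ((nc₁ + (nc₂ + nk₁₂)) + (nc₃ + nkL))) =
      ncokR + (na₁ + (nc₁ + ((nc₂ + (nc₃ + nk₂₃)) + nkR)))) :
    Orientation.reindex ℝ _ (finCongr hNL)
        (Orientation.map (Fin (ncokL + (na₁ + ((nc₁ + (nc₂ + nk₁₂)) + (nc₃ + nkL))))) TL νL) =
      Orientation.map (Fin (ncokR + (na₁ + (nc₁ + ((nc₂ + (nc₃ + nk₂₃)) + nkR))))) TR νR := by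
  obtain ⟨d₁₂, H₁₂, s₁₂, hd₁₂, hd₁₂', hs₁₂⟩ := h₁₂.exists_splitting
  obtain ⟨d₂₃, H₂₃, s₂₃, hd₂₃, hd₂₃', hs₂₃⟩ := h₂₃.exists_splitting
  obtain ⟨dL, HL, sL, hdL, hdL', hsL⟩ := hL.exists_splitting
  obtain ⟨dR, HR, sR, hdR, hdR', hsR⟩ := hR.exists_splitting
  obtain ⟨⟨⟨a₁⟩, ⟨b₁⟩, ⟨c₁⟩⟩, ⟨⟨a₂⟩, ⟨b₂⟩, ⟨c₂⟩⟩, ⟨e₁₂⟩, ⟨z₁₂⟩⟩ := h₁₂.nonempty_bases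
  obtain ⟨-, ⟨⟨a₃⟩, ⟨b₃⟩, ⟨c₃⟩⟩, ⟨e₂₃⟩, ⟨z₂₃⟩⟩ := h₂₃.nonempty_bases
  obtain ⟨-, -, ⟨eL⟩, ⟨zL⟩⟩ := hL.nonempty_bases
  obtain ⟨-, -, ⟨eR⟩, ⟨zR⟩⟩ := hR.nonempty_bases
  clear h₁₂ h₂₃ hL hR
  let e := finBasis ℝ ((B₁ × B₂ × B₃) ⧸ LinearMap.range f)
  let z := finBasis ℝ (LinearMap.ker f)
  have hk : nk₁₂ + nkL = nk₂₃ + nkR :=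
    ((prodBasis z₁₂ zL).map (ΦL.symm ≪≫ₗ ΦR)).fin_dim_eq (prodBasis z₂₃ zR)
  -- the cokernel isomorphisms
  obtain ⟨ΨL, hΨL, hTL'⟩ := TL.exists_eq_prodCongr
    ((LinearEquiv.refl ℝ A₁).prodCongr (leftShuffle C₁ C₂ C₃ ΦL))
    ((LinearMap.range g).mkQ ∘ₗ
      ((LinearMap.range f₁₂).mkQ.prodMap LinearMap.id) ∘ₗ
        (LinearEquiv.prodAssoc ℝ B₁ B₂ B₃).symm.toLinearMap)
    ((Submodule.mkQ_surjective _).comp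
      (((Submodule.mkQ_surjective _).prodMap Function.surjective_id).comp
        (LinearEquiv.surjective _)))
    (LinearMap.range f).mkQ (Submodule.mkQ_surjective _)
    (fun w x => hTL w x.1 x.2.1.1 x.2.1.2.1 x.2.2.1 x.2.1.2.2 x.2.2.2)
  obtain ⟨ΨR, hΨR, hTR'⟩ := TR.exists_eq_prodCongr
    ((LinearEquiv.refl ℝ A₁).prodCongr (rightShuffle C₁ C₂ C₃ ΦR))
    ((LinearMap.range g').mkQ ∘ₗ (LinearMap.id.prodMap (LinearMap.range f₂₃).mkQ))
    ((Submodule.mkQ_surjective _).comp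
      (Function.surjective_id.prodMap (Submodule.mkQ_surjective _)))
    (LinearMap.range f).mkQ (Submodule.mkQ_surjective _)
    (fun w x => hTR w x.1 x.2.1 x.2.2.1.1 x.2.2.1.2.1 x.2.2.1.2.2 x.2.2.2)
  have hTLs : TL.orSign (prodBasis eL (prodBasis a₁ (prodBasis (prodBasis c₁ (prodBasis c₂ z₁₂))
      (prodBasis c₃ zL)))) (prodBasis e (prodBasis a₁ (prodBasis c₁ (prodBasis c₂
        (prodBasis c₃ z))))) =
      ΨL.orSign eL e * (1 * ((-1) ^ (nk₁₂ * nc₃) * ΦL.orSign z (prodBasis z₁₂ zL))) := by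
    rw [hTL']
    exact LinearEquiv.orSign_prodCongr_of rfl (LinearEquiv.orSign_prodCongr_of
      (LinearEquiv.orSign_refl_self a₁) (orSign_leftShuffle ΦL c₁ c₂ c₃ z z₁₂ zL))
  have hTRs : TR.orSign (prodBasis eR (prodBasis a₁ (prodBasis c₁ (prodBasis (prodBasis c₂
      (prodBasis c₃ z₂₃)) zR)))) (prodBasis e (prodBasis a₁ (prodBasis c₁ (prodBasis c₂
        (prodBasis c₃ z))))) =
      ΨR.orSign eR e * (1 * ΦR.orSign z (prodBasis z₂₃ zR)) := by
    rw [hTR']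
    exact LinearEquiv.orSign_prodCongr_of rfl (LinearEquiv.orSign_prodCongr_of
      (LinearEquiv.orSign_refl_self a₁) (orSign_rightShuffle ΦR c₁ c₂ c₃ z z₂₃ zR))
  clear hTL hTR hTL' hTR'
  have hcmp := IsSplitting.orSign_assoc hf hg hg' s₁₂ s₂₃ sL sR ΦL hΦL₁ hΦL₂ ΦR hΦR₁ hΦR₂ ΨL hΨL
    ΨR hΨR a₂ a₃ b₁ b₂ b₃ e₁₂ z₁₂ e₂₃ z₂₃ eL zL eR zR e z
  have hpar := associativity_parity (nc₂ := nc₂) (nc₃ := nc₃) hd₁₂ hd₁₂' hd₂₃ hd₂₃' hdL' hdR' hk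
  set XL := prodBasis eL (prodBasis a₁ (prodBasis (prodBasis c₁ (prodBasis c₂ z₁₂))
    (prodBasis c₃ zL)))
  set XR := prodBasis eR (prodBasis a₁ (prodBasis c₁ (prodBasis (prodBasis c₂ (prodBasis c₃ z₂₃))
    zR)))
  set X := prodBasis e (prodBasis a₁ (prodBasis c₁ (prodBasis c₂ (prodBasis c₃ z))))
  have hrel : relSign (XL.map TL) (XR.map TR) = TL.orSign XL X * TR.orSign XR X :=
    (relSign_trans (XL.map TL) X (XR.map TR)).symm.trans
      (congrArg (TL.orSign XL X * ·) (relSign_comm X (XR.map TR)))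
  have hl := hsL a₁ e₁₂ (prodBasis c₁ (prodBasis c₂ z₁₂)) a₃ b₃ c₃ eL zL
  have hr := hsR a₁ b₁ c₁ a₂ e₂₃ (prodBasis c₂ (prodBasis c₃ z₂₃)) eR zR
  rw [hs₁₂ a₁ b₁ c₁ a₂ b₂ c₂] at hl
  rw [hs₂₃ a₂ b₂ c₂ a₃ b₃ c₃] at hr
  apply Orientation.ext_basisSign (XR.map TR)
  refine (Orientation.basisSign_reindex _ (XL.map TL) hNL (XR.map TR)).trans <|
    (congrArg₂ (· * ·) (νL.basisSign_map XL TL) hrel).trans <|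
    Eq.trans ?_ (νR.basisSign_map XR TR).symm
  rw [hl, hr, hTLs, hTRs]
  simp only [one_mul]
  exact units_mul_eq_of_parity hpar hcmp

end
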